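/- (1-Key Property) Let T be a normal standard finite tree and {f_ξ : ξ ∈ A} a finite indexed family of standard functions on T. Assume α < β in ht[T], X ⊆ T_α, {f_ξ : ξ ∈ A} is separated on X, and whenever f_τ(x) = y with x, y ∈ X and τ ∈ A, then Succ_T(x) ⊆ dom(f_τ) and Succ_T(y) ⊆ ran(f_τ). Then for every b ∈ T_β with b↾α ∈ X, there exists Y ⊆ T_β with unique drop-downs to α such that Y↾α = X, b ∈ Y, and for all τ ∈ A, X and Y are f_τ-consistent. -/

import Mathlib

noncomputable section
open scoped Classical

namespace AKST

/-- The first uncountable ordinal. -/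
def ω1 : Ordinal := (Cardinal.aleph 1).ord

/-- The second uncountable ordinal. -/
def ω2 : Ordinal := (Cardinal.aleph 2).ord

/-- The height of a countable ordinal `γ`: the unique `α` with `ω·α ≤ γ < ω·(α+1)`. -/
def ht (γ : Ordinal) : Ordinal := γ / Ordinal.omega0

/-- A standard finite tree. -/
structure SFT where
  elems : Finset Ordinal
  lt : Ordinal → Ordinal → Prop
  zero_mem : 0 ∈ elems
  mem_ok : ∀ x ∈ elems, x = 0 ∨ (Ordinal.omega0 ≤ x ∧ x < ω1)
  lt_mem : ∀ {x y}, lt x y → x ∈ elems ∧ y ∈ elems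
  lt_trans' : ∀ {x y z}, lt x y → lt y z → lt x z
  lt_irrefl' : ∀ x, ¬ lt x x
  pred_linear : ∀ {x y z}, lt y x → lt z x → lt y z ∨ y = z ∨ lt z y
  lt_ht : ∀ {x y}, lt x y → ht x < ht y
  pred_level : ∀ x ∈ elems, ∀ α, (∃ z ∈ elems, ht z = α) → α < ht x →
    ∃ y ∈ elems, ht y = α ∧ lt y x

namespace SFT

/-- The non-strict tree order. -/
def le (T : SFT) (x y : Ordinal) : Prop := T.lt x y ∨ (x = y ∧ x ∈ T.elems)

/-- `ht[T]`: the set of nonzero heights of elements of `T`. -/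
def heights (T : SFT) : Set Ordinal := {α | α ≠ 0 ∧ ∃ x ∈ T.elems, ht x = α}

/-- Level `α` of `T`. -/
def level (T : SFT) (α : Ordinal) : Set Ordinal := {x | x ∈ T.elems ∧ ht x = α}

/-- `max(ht[T])`. -/
def maxHeight (T : SFT) : Ordinal := sSup T.heights

/-- The least element of `ht[T]` greater than `α`. -/
def minAbove (T : SFT) (α : Ordinal) : Ordinal := sInf {β | β ∈ T.heights ∧ α < β}

/-- The drop-down `x↾α`: the unique element of `T` of height `α` below `x`. -/
def drop (T : SFT) (α x : Ordinal) : Ordinal :=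
  if h : ∃ y, y ∈ T.elems ∧ ht y = α ∧ T.lt y x then h.choose else 0

/-- `z` is the meet of `x` and `y` in `T`. -/
def isMeet (T : SFT) (x y z : Ordinal) : Prop :=
  T.le z x ∧ T.le z y ∧ ∀ w, T.le w x → T.le w y → T.le w z

/-- The meet `x ∧_T y`. -/
def meet (T : SFT) (x y : Ordinal) : Ordinal :=
  if h : ∃ z, T.isMeet x y z then h.choose else 0

/-- `U` extends `T`. -/
def Ext (T U : SFT) : Prop :=
  (↑T.elems : Set Ordinal) ⊆ ↑U.elems ∧ ∀ {x y}, T.lt x y → U.lt x y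

/-- `X` has unique drop-downs to `α` in `T`. -/
def UniqueDrops (T : SFT) (α : Ordinal) (X : Set Ordinal) : Prop :=
  ∀ x ∈ X, ∀ y ∈ X, T.drop α x = T.drop α y → x = y

/-- `U` is a simple extension of `T`. -/
def SimpleExt (U T : SFT) : Prop :=
  Ext T U ∧
  (∀ x ∈ U.elems, x ∉ T.elems → ht x ∉ T.heights) ∧
  (∀ α, α ∈ U.heights → α ∉ T.heights → α < T.maxHeight →
     U.UniqueDrops α (T.level (T.minAbove α)))

/-- `x` and `y` are incomparable in `T`. -/
def Incomp (T : SFT) (x y : Ordinal) : Prop := x ≠ y ∧ ¬ T.lt x y ∧ ¬ T.lt y x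

/-- `T` is normal: every element has successors at every higher occupied level. -/
def Normal (T : SFT) : Prop :=
  ∀ x ∈ T.elems, ∀ γ ∈ T.heights, ht x < γ → ∃ y ∈ T.elems, ht y = γ ∧ T.lt x y

end SFT

/-! Partial functions on a tree, represented by their graphs. -/

def dom (f : Set (Ordinal × Ordinal)) : Set Ordinal := {x | ∃ y, (x, y) ∈ f}

def ran (f : Set (Ordinal × Ordinal)) : Set Ordinal := {y | ∃ x, (x, y) ∈ f}

/-- The graph is single-valued. -/
def FuncGraph (f : Set (Ordinal × Ordinal)) : Prop :=
  ∀ {x y y'}, (x, y) ∈ f → (x, y') ∈ f → y = y'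

/-- The graph is injective. -/
def InjGraph (f : Set (Ordinal × Ordinal)) : Prop :=
  ∀ {x x' y}, (x, y) ∈ f → (x', y) ∈ f → x = x'

/-- The graph is a partial function from `T` to `T`. -/
def Carr (T : SFT) (f : Set (Ordinal × Ordinal)) : Prop :=
  ∀ p ∈ f, p.1 ∈ T.elems ∧ p.2 ∈ T.elems

/-- Strictly increasing. -/
def StrictIncr (T : SFT) (f : Set (Ordinal × Ordinal)) : Prop :=
  ∀ {x y x' y'}, (x, y) ∈ f → (x', y') ∈ f → T.lt x x' → T.lt y y'

/-- Level preserving. -/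
def LevelPres (f : Set (Ordinal × Ordinal)) : Prop :=
  ∀ p ∈ f, ht p.1 = ht p.2

/-- Downwards closed (the domain is closed under drop-downs). -/
def DownClosedDom (T : SFT) (f : Set (Ordinal × Ordinal)) : Prop :=
  ∀ x y, (x, y) ∈ f → ∀ β ∈ T.heights, β < ht x →
    ∃ x' y', x' ∈ T.elems ∧ ht x' = β ∧ T.lt x' x ∧ (x', y') ∈ f

/-- No fixed points other than 0. -/
def NoFix (f : Set (Ordinal × Ordinal)) : Prop := ∀ x, (x, x) ∈ f → x = 0

/-- `f` is a standard function on `T`. -/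
def IsStdFun (T : SFT) (f : Set (Ordinal × Ordinal)) : Prop :=
  Carr T f ∧ FuncGraph f ∧ InjGraph f ∧ StrictIncr T f ∧ LevelPres f ∧
    DownClosedDom T f ∧ NoFix f

/-- `f^m(x) = y`, for `m ∈ {-1, 1}`. -/
def appPow (f : Set (Ordinal × Ordinal)) (m : ℤ) (x y : Ordinal) : Prop :=
  (m = 1 ∧ (x, y) ∈ f) ∨ (m = -1 ∧ (y, x) ∈ f)

/-- `X↾α` and `X` are `f`-consistent. -/
def Consistent (T : SFT) (f : Set (Ordinal × Ordinal)) (α : Ordinal) (X : Set Ordinal) : Prop :=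
  ∀ x ∈ X, ∀ y ∈ X, ((T.drop α x, T.drop α y) ∈ f ↔ (x, y) ∈ f)

/-- The family `{F τ : τ ∈ A}` is separated on the tuple `a 0, ..., a (n-1)`. -/
def SepOnTuple (F : Ordinal → Set (Ordinal × Ordinal)) (A : Finset Ordinal)
    (n : ℕ) (a : ℕ → Ordinal) : Prop :=
  ∀ i < n, ∀ j₀ < i, ∀ j₁ < i, ∀ m₀ m₁ : ℤ, ∀ τ₀ ∈ A, ∀ τ₁ ∈ A,
    (m₀ = 1 ∨ m₀ = -1) → (m₁ = 1 ∨ m₁ = -1) →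
    appPow (F τ₀) m₀ (a i) (a j₀) → appPow (F τ₁) m₁ (a i) (a j₁) →
    j₀ = j₁ ∧ m₀ = m₁ ∧ τ₀ = τ₁

/-- The family is separated on the set `X`. -/
def SepOnSet (F : Ordinal → Set (Ordinal × Ordinal)) (A : Finset Ordinal)
    (X : Set Ordinal) : Prop :=
  ∃ (n : ℕ) (a : ℕ → Ordinal), (∀ i < n, ∀ j < n, a i = a j → i = j) ∧
    X = a '' {i | i < n} ∧ SepOnTuple F A n a

/-- The family is `ρ`-separated on the tuple `a 0, ..., a (n-1)` (of elements of level `α`). -/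
def RhoSepOnTuple (ρ : Ordinal → Ordinal → Ordinal) (F : Ordinal → Set (Ordinal × Ordinal))
    (A : Finset Ordinal) (α : Ordinal) (n : ℕ) (a : ℕ → Ordinal) : Prop :=
  ∀ i < n, ∀ j₀ < i, ∀ j₁ < i, ∀ m₀ m₁ : ℤ, ∀ τ₀ ∈ A, ∀ τ₁ ∈ A,
    (m₀ = 1 ∨ m₀ = -1) → (m₁ = 1 ∨ m₁ = -1) →
    appPow (F τ₀) m₀ (a i) (a j₀) → appPow (F τ₁) m₁ (a i) (a j₁) →
    j₀ = j₁ ∧ ((m₀ = m₁ ∧ τ₀ = τ₁) ∨ α ≤ ρ τ₀ τ₁)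

/-- The family is `ρ`-separated on the set `X ⊆ T_α`. -/
def RhoSepOnSet (ρ : Ordinal → Ordinal → Ordinal) (F : Ordinal → Set (Ordinal × Ordinal))
    (A : Finset Ordinal) (α : Ordinal) (X : Set Ordinal) : Prop :=
  ∃ (n : ℕ) (a : ℕ → Ordinal), (∀ i < n, ∀ j < n, a i = a j → i = j) ∧
    X = a '' {i | i < n} ∧ RhoSepOnTuple ρ F A α n a

/-- There is a loop in `X` with respect to the family `{F τ : τ ∈ A}`. -/
def HasLoop (F : Ordinal → Set (Ordinal × Ordinal)) (A : Finset Ordinal)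
    (X : Set Ordinal) : Prop :=
  ∃ p : ℕ, 4 ≤ p ∧ ∃ c : ℕ → Ordinal,
    (∀ i < p, c i ∈ X) ∧
    (∀ i < p - 1, ∀ j < p - 1, c i = c j → i = j) ∧
    c 0 = c (p - 1) ∧
    (∀ i < p - 1, ∃ τ ∈ A, ∃ m : ℤ, (m = 1 ∨ m = -1) ∧ appPow (F τ) m (c i) (c (i + 1)))

/-- `p` is a member of `T ⊗ T`. -/
def InOtimes (T : SFT) (p : Ordinal × Ordinal) : Prop :=
  p.1 ∈ T.elems ∧ p.2 ∈ T.elems ∧ ht p.1 = ht p.2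

/-- `f ⊆ T ⊗ T` is downwards closed as a subset of `T ⊗ T`. -/
def DCPairs (T : SFT) (f : Set (Ordinal × Ordinal)) : Prop :=
  ∀ p ∈ f, ∀ q, InOtimes T q → T.le q.1 p.1 → T.le q.2 p.2 → q ∈ f

/-- The downward closure of `f` in `U`. -/
def dcl (U : SFT) (f : Set (Ordinal × Ordinal)) : Set (Ordinal × Ordinal) :=
  {p | InOtimes U p ∧ ∃ q ∈ f, U.le p.1 q.1 ∧ U.le p.2 q.2}

end AKST

open AKST AKST.SFT

namespace AKST

theorem SFT.eq_of_lt_of_ht_eq (T : SFT) {x y z : Ordinal} (hy : T.lt y x) (hz : T.lt z x)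
    (h : ht y = ht z) : y = z := by
  rcases T.pred_linear hy hz with h' | h' | h'
  · exact absurd h (T.lt_ht h').ne
  · exact h'
  · exact absurd h (T.lt_ht h').ne'

theorem SFT.drop_eq (T : SFT) {α x y : Ordinal} (hxy : T.lt x y) (hx : ht x = α) :
    T.drop α y = x := by
  have h : ∃ z, z ∈ T.elems ∧ ht z = α ∧ T.lt z y := ⟨x, (T.lt_mem hxy).1, hx, hxy⟩
  rw [SFT.drop, dif_pos h]
  exact T.eq_of_lt_of_ht_eq h.choose_spec.2.2 hxy (h.choose_spec.2.1.trans hx.symm)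

theorem SFT.drop_lt (T : SFT) {α y : Ordinal} (hy : y ∈ T.elems) (hα : α ∈ T.heights)
    (h : α < ht y) : T.lt (T.drop α y) y := by
  obtain ⟨x, -, hx, hxy⟩ := T.pred_level y hy α hα.2 h
  rwa [T.drop_eq hxy hx]

/-- A standard function relates the drop-downs of related elements. -/
theorem IsStdFun.mem_of_lt {T : SFT} {f : Set (Ordinal × Ordinal)} (hf : IsStdFun T f)
    {α x y z w : Ordinal} (hα : α ∈ T.heights) (hx : ht x = α) (hy : ht y = α)
    (hxz : T.lt x z) (hyw : T.lt y w) (hzw : (z, w) ∈ f) : (x, y) ∈ f := by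
  obtain ⟨-, -, -, hincr, hlev, hdc, -⟩ := hf
  obtain ⟨x', y', -, hx', hxz', hm⟩ := hdc z w hzw α hα (hx ▸ T.lt_ht hxz)
  have hyw' : T.lt y' w := hincr hm hzw hxz'
  have hy' : ht x' = ht y' := hlev _ hm
  obtain rfl := T.eq_of_lt_of_ht_eq hxz hxz' (hx.trans hx'.symm)
  obtain rfl := T.eq_of_lt_of_ht_eq hyw hyw' (hy.trans (hx.symm.trans hy'))
  exact hm

theorem appPow_symm {f : Set (Ordinal × Ordinal)} {m : ℤ} {x y : Ordinal} (h : appPow f m x y) :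
    appPow f (-m) y x := by
  rcases h with ⟨rfl, h⟩ | ⟨rfl, h⟩
  · exact Or.inr ⟨rfl, h⟩
  · exact Or.inl ⟨rfl, h⟩

/-- An edge between elements of level `α` lifts to any successor of its source. -/
theorem IsStdFun.exists_appPow {T : SFT} {f : Set (Ordinal × Ordinal)} (hf : IsStdFun T f)
    {α : Ordinal} (hα : α ∈ T.heights) {X : Set Ordinal} (hX : X ⊆ T.level α)
    (hclosed : ∀ x ∈ X, ∀ y ∈ X, (x, y) ∈ f →
      (∀ z, T.lt x z → z ∈ dom f) ∧ (∀ z, T.lt y z → z ∈ ran f))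
    {m : ℤ} {x y z : Ordinal} (hx : x ∈ X) (hy : y ∈ X) (h : appPow f m x y) (hxz : T.lt x z) :
    ∃ w, T.lt y w ∧ ht w = ht z ∧ appPow f m z w := by
  obtain ⟨hcarr, -, hinj, hincr, hlev, -, -⟩ := id hf
  rcases h with ⟨rfl, h⟩ | ⟨rfl, h⟩
  · obtain ⟨w, hw⟩ := (hclosed x hx y hy h).1 z hxz
    exact ⟨w, hincr h hw hxz, (hlev _ hw).symm, Or.inl ⟨rfl, hw⟩⟩
  · obtain ⟨w, hw⟩ := (hclosed y hy x hx h).2 z hxz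
    have hwz : ht w = ht z := hlev _ hw
    have hαw : α < ht w := by rw [hwz, ← (hX hx).2]; exact T.lt_ht hxz
    obtain ⟨y', -, hy', hyw⟩ := T.pred_level w (hcarr _ hw).1 α hα.2 hαw
    obtain rfl : y' = y := hinj (hf.mem_of_lt hα hy' (hX hx).2 hyw hxz hw) h
    exact ⟨w, hyw, hwz, Or.inr ⟨rfl, hw⟩⟩

/-- A separated tuple lifts to level `β` with one prescribed value, preserving all edges. -/
theorem exists_lift_of_sepOnTuple {T : SFT} (hnorm : T.Normal)
    {F : Ordinal → Set (Ordinal × Ordinal)} {A : Finset Ordinal}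
    (hstd : ∀ τ ∈ A, IsStdFun T (F τ))
    {α β : Ordinal} (hα : α ∈ T.heights) (hβ : β ∈ T.heights) (hαβ : α < β)
    {X : Set Ordinal} (hX : X ⊆ T.level α)
    (hclosed : ∀ τ ∈ A, ∀ x ∈ X, ∀ y ∈ X, (x, y) ∈ F τ →
      (∀ z, T.lt x z → z ∈ dom (F τ)) ∧ (∀ z, T.lt y z → z ∈ ran (F τ)))
    (a : ℕ → Ordinal) (k : ℕ) (haX : ∀ i < k, a i ∈ X) (hsep : SepOnTuple F A k a)
    (i₀ : ℕ) (b : Ordinal) (hb : ht b = β) (hlt : T.lt (a i₀) b) :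
    ∃ g : ℕ → Ordinal, (i₀ < k → g i₀ = b) ∧ (∀ i < k, T.lt (a i) (g i) ∧ ht (g i) = β) ∧
      ∀ i < k, ∀ j < k, ∀ τ ∈ A, (a i, a j) ∈ F τ → (g i, g j) ∈ F τ := by
  induction k generalizing i₀ b with
  | zero => exact ⟨a, by simp⟩
  | succ k ih =>
    replace ih := ih (fun i hi => haX i (by omega)) (fun i hi => hsep i (by omega))
    have hak := haX k (by omega)
    -- It suffices to lift the first `k` entries compatibly with a choice of the last value.
    suffices H : ∃ (g : ℕ → Ordinal) (c : Ordinal), (i₀ < k → g i₀ = b) ∧ (i₀ = k → c = b) ∧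
        T.lt (a k) c ∧ ht c = β ∧ (∀ i < k, T.lt (a i) (g i) ∧ ht (g i) = β) ∧
        (∀ i < k, ∀ j < k, ∀ τ ∈ A, (a i, a j) ∈ F τ → (g i, g j) ∈ F τ) ∧
        ∀ j < k, ∀ τ ∈ A, ∀ m, appPow (F τ) m (a k) (a j) → appPow (F τ) m c (g j) by
      obtain ⟨g, c, hgb, hcb, hc, hcβ, hg, hE, hEk⟩ := H
      refine ⟨Function.update g k c, fun hi => ?_, fun i hi => ?_, fun i hi j hj τ hτ h => ?_⟩
      · rcases eq_or_ne i₀ k with rfl | h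
        · simpa using hcb rfl
        · simpa [h] using hgb (by omega)
      · rcases eq_or_ne i k with rfl | h
        · simpa using ⟨hc, hcβ⟩
        · simpa [h] using hg i (by omega)
      · rcases eq_or_ne i k with hik | hik <;> rcases eq_or_ne j k with hjk | hjk
        · subst hik hjk
          have h0 := (hstd τ hτ).2.2.2.2.2.2 _ h
          refine absurd (hX hak).2 ?_
          rw [h0, ht, Ordinal.zero_div]
          exact hα.1.symm
        · subst hik
          have := hEk j (by omega) τ hτ 1 (Or.inl ⟨rfl, h⟩)
          simpa [appPow, hjk] using this
        · subst hjk
          have := hEk i (by omega) τ hτ (-1) (Or.inr ⟨rfl, h⟩)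
          simpa [appPow, hik] using this
        · simpa [hik, hjk] using hE i (by omega) j (by omega) τ hτ h
    have hsign : ∀ {f : Set (Ordinal × Ordinal)} {m x y}, appPow f m x y → m = 1 ∨ m = -1 :=
      fun h => h.imp And.left And.left
    by_cases hedge : ∃ j < k, ∃ τ ∈ A, ∃ m, appPow (F τ) m (a k) (a j)
    · obtain ⟨j, hj, τ, hτ, m, h⟩ := hedge
      have huniq : ∀ j' < k, ∀ τ' ∈ A, ∀ m', appPow (F τ') m' (a k) (a j') →
          j' = j ∧ m' = m ∧ τ' = τ := fun j' hj' τ' hτ' m' h' =>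
        hsep k (by omega) j' hj' j hj m' m τ' hτ' τ hτ (hsign h') (hsign h) h' h
      have haj := haX j (by omega)
      rcases eq_or_ne i₀ k with rfl | hi
      · obtain ⟨w, hw, hwb, hbw⟩ :=
          (hstd τ hτ).exists_appPow hα hX (hclosed τ hτ) hak haj h hlt
        obtain ⟨g, hgj, hg, hE⟩ := ih j w (hwb.trans hb) hw
        refine ⟨g, b, fun h => absurd h (lt_irrefl _), fun _ => rfl, hlt, hb, hg, hE, ?_⟩
        intro j' hj' τ' hτ' m' h'
        obtain ⟨rfl, rfl, rfl⟩ := huniq j' hj' τ' hτ' m' h'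
        rwa [hgj hj]
      · obtain ⟨g, hgb, hg, hE⟩ := ih i₀ b hb hlt
        obtain ⟨c, hc, hcg, hgc⟩ := (hstd τ hτ).exists_appPow hα hX (hclosed τ hτ)
          haj hak (appPow_symm h) (hg j hj).1
        refine ⟨g, c, hgb, fun h => absurd h hi, hc, hcg.trans (hg j hj).2, hg, hE, ?_⟩
        intro j' hj' τ' hτ' m' h'
        obtain ⟨rfl, rfl, rfl⟩ := huniq j' hj' τ' hτ' m' h'
        simpa using appPow_symm hgc
    · obtain ⟨g, hgb, hg, hE⟩ := ih i₀ b hb hlt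
      obtain ⟨c, hcb, hc, hcβ⟩ : ∃ c, (i₀ = k → c = b) ∧ T.lt (a k) c ∧ ht c = β := by
        rcases eq_or_ne i₀ k with rfl | hi
        · exact ⟨b, fun _ => rfl, hlt, hb⟩
        · obtain ⟨c, -, hcβ, hc⟩ := hnorm (a k) (hX hak).1 β hβ ((hX hak).2 ▸ hαβ)
          exact ⟨c, fun h => absurd h hi, hc, hcβ⟩
      exact ⟨g, c, hgb, hcb, hc, hcβ, hg, hE,
        fun j hj τ hτ m h => absurd ⟨j, hj, τ, hτ, m, h⟩ hedge⟩

end AKST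

/-- 1-Key Property. -/
theorem stmt_13 (T : SFT) (hnorm : T.Normal)
    (F : Ordinal → Set (Ordinal × Ordinal)) (A : Finset Ordinal)
    (hstd : ∀ τ ∈ A, IsStdFun T (F τ))
    (α β : Ordinal) (hα : α ∈ T.heights) (hβ : β ∈ T.heights) (hαβ : α < β)
    (X : Set Ordinal) (hX : X ⊆ T.level α) (hsep : SepOnSet F A X)
    (hclosed : ∀ τ ∈ A, ∀ x ∈ X, ∀ y ∈ X, (x, y) ∈ F τ →
      (∀ z, T.lt x z → z ∈ dom (F τ)) ∧ (∀ z, T.lt y z → z ∈ ran (F τ))) :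
    ∀ b ∈ T.level β, T.drop α b ∈ X →
      ∃ Y : Set Ordinal, Y ⊆ T.level β ∧ UniqueDrops T α Y ∧
        T.drop α '' Y = X ∧ b ∈ Y ∧ ∀ τ ∈ A, Consistent T (F τ) α Y := by
  rintro b ⟨hbT, hb⟩ hbX
  obtain ⟨n, a, hinj, rfl, hsep⟩ := hsep
  have haX : ∀ i < n, a i ∈ a '' {i | i < n} := fun i hi => ⟨i, hi, rfl⟩
  have hltb := T.drop_lt hbT hα (hb.symm ▸ hαβ)
  obtain ⟨i₀, hi₀, hab⟩ := hbX
  obtain ⟨g, hgb, hg, hE⟩ := exists_lift_of_sepOnTuple hnorm hstd hα hβ hαβ hX hclosed a n haX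
    hsep i₀ b hb (hab ▸ hltb)
  have haα : ∀ i < n, ht (a i) = α := fun i hi => (hX (haX i hi)).2
  have hdrop : ∀ i < n, T.drop α (g i) = a i := fun i hi => T.drop_eq (hg i hi).1 (haα i hi)
  refine ⟨g '' {i | i < n}, ?_, ?_, ?_, ⟨i₀, hi₀, hgb hi₀⟩, ?_⟩
  · rintro _ ⟨i, hi, rfl⟩
    exact ⟨(T.lt_mem (hg i hi).1).2, (hg i hi).2⟩
  · rintro _ ⟨i, hi, rfl⟩ _ ⟨j, hj, rfl⟩ h
    rw [hdrop i hi, hdrop j hj] at h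
    rw [hinj i hi j hj h]
  · rw [Set.image_image]
    exact Set.image_congr hdrop
  · rintro τ hτ _ ⟨i, hi, rfl⟩ _ ⟨j, hj, rfl⟩
    rw [hdrop i hi, hdrop j hj]
    exact ⟨hE i hi j hj τ hτ, (hstd τ hτ).mem_of_lt hα (haα i hi) (haα j hj)
      (hg i hi).1 (hg j hj).1⟩
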